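/- arXiv:1309.0157 — 3 statements merged into one kernel-verified Lean document; each statement's English description precedes it below -/
import Mathlib

section
/- Define a : ℕ → ℕ by a(0) = 1, a(m) = 2^m·3^{m-1} + 2^{m+1}·3^{m/2 - 1} for m even, m ≥ 2, and a(m) = 2^m·3^{m-1} + 2^m·3^{(m-1)/2} for m odd. Then for every positive integer n, ∑_{m=0}^{n} a(m)·2^{n-m} = 2^{n-1}·(3^n + 3·3^{n/2} - 2) if n is even, and ∑_{m=0}^{n} a(m)·2^{n-m} = 2^{n-1}·(3^n + 5·3^{(n-1)/2} - 2) if n is odd. -/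
/-- The sum `∑ a m * 2 ^ (n - m)` satisfies a first-order linear recurrence in `n`. -/
theorem sum_mul_two_pow_sub_succ (a : ℕ → ℕ) (n : ℕ) :
    ∑ m ∈ Finset.range (n + 2), a m * 2 ^ (n + 1 - m) =
      2 * (∑ m ∈ Finset.range (n + 1), a m * 2 ^ (n - m)) + a (n + 1) := by
  rw [Finset.sum_range_succ, Finset.mul_sum, Nat.sub_self, pow_zero, mul_one]
  congr 1
  refine Finset.sum_congr rfl fun m hm => ?_
  have hmn : m ≤ n := Nat.lt_succ_iff.mp (Finset.mem_range.mp hm)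
  rw [Nat.sub_add_comm hmn, pow_succ]
  ring


/-- Corollary 1 of the paper: if `a m = |B'_m|` is given by the closed form of
Theorem 1 (with `a 0 = 1`), then `|B_n| = ∑_{m=0}^n a m · 2^(n-m)` has the
stated closed form. -/
theorem stmt2 (a : ℕ → ℕ) (h0 : a 0 = 1)
    (heven : ∀ m, 0 < m → Even m →
      a m = 2 ^ m * 3 ^ (m - 1) + 2 ^ (m + 1) * 3 ^ (m / 2 - 1))
    (hodd : ∀ m, Odd m →
      a m = 2 ^ m * 3 ^ (m - 1) + 2 ^ m * 3 ^ ((m - 1) / 2))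
    (n : ℕ) (hn : 0 < n) :
    (Even n →
      ∑ m ∈ Finset.range (n + 1), a m * 2 ^ (n - m) =
        2 ^ (n - 1) * (3 ^ n + 3 * 3 ^ (n / 2) - 2)) ∧
    (Odd n →
      ∑ m ∈ Finset.range (n + 1), a m * 2 ^ (n - m) =
        2 ^ (n - 1) * (3 ^ n + 5 * 3 ^ ((n - 1) / 2) - 2)) := by
  have ha_odd (k : ℕ) : a (2 * k + 1) = 2 * 4 ^ k * 9 ^ k + 2 * 4 ^ k * 3 ^ k := by
    rw [hodd _ ⟨k, rfl⟩, Nat.add_sub_cancel, Nat.mul_div_cancel_left k two_pos]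
    simp only [pow_succ, pow_mul]
    norm_num
    ring
  have ha_even (k : ℕ) : a (2 * k + 2) = 12 * 4 ^ k * 9 ^ k + 8 * 4 ^ k * 3 ^ k := by
    rw [heven _ (by omega) ⟨k + 1, by ring⟩, show 2 * k + 2 - 1 = 2 * k + 1 by omega,
      show (2 * k + 2) / 2 - 1 = k by omega]
    simp only [pow_succ, pow_mul]
    norm_num
    ring
  have hsum_even (k : ℕ)
      (h : ∑ m ∈ Finset.range (2 * k + 1 + 1), a m * 2 ^ (2 * k + 1 - m) + 2 * 4 ^ k =
        4 ^ k * (3 * 9 ^ k + 5 * 3 ^ k)) :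
      ∑ m ∈ Finset.range (2 * k + 2 + 1), a m * 2 ^ (2 * k + 2 - m) + 4 * 4 ^ k =
        2 * 4 ^ k * (9 * 9 ^ k + 9 * 3 ^ k) := by
    rw [sum_mul_two_pow_sub_succ a (2 * k + 1), ha_even]
    linear_combination 2 * h
  have hsum_odd (k : ℕ) :
      ∑ m ∈ Finset.range (2 * k + 1 + 1), a m * 2 ^ (2 * k + 1 - m) + 2 * 4 ^ k =
        4 ^ k * (3 * 9 ^ k + 5 * 3 ^ k) := by
    induction k with
    | zero =>
      have h1 := ha_odd 0
      norm_num at h1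
      simp [Finset.sum_range_succ, h0, h1]
    | succ k ih =>
      have h := hsum_even k ih
      have h1 := ha_odd (k + 1)
      rw [sum_mul_two_pow_sub_succ a (2 * (k + 1)), h1]
      simp only [mul_add, mul_one, pow_succ] at h ⊢
      linear_combination 2 * h
  refine ⟨fun he => ?_, fun ho => ?_⟩
  · obtain ⟨k, rfl⟩ : ∃ k, n = 2 * k + 2 := by
      obtain ⟨r, rfl⟩ := he
      exact ⟨r - 1, by omega⟩
    rw [Nat.mul_sub, show 2 * k + 2 - 1 = 2 * k + 1 by omega,
      show (2 * k + 2) / 2 = k + 1 by omega]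
    refine Nat.eq_sub_of_add_eq ?_
    have h := hsum_even k (hsum_odd k)
    rw [pow_succ 2 (2 * k), pow_add 3 (2 * k), pow_mul, pow_mul, pow_succ 3 k]
    norm_num
    linear_combination h
  · obtain ⟨k, rfl⟩ := ho
    rw [Nat.mul_sub, Nat.add_sub_cancel, Nat.mul_div_cancel_left k two_pos]
    refine Nat.eq_sub_of_add_eq ?_
    have h := hsum_odd k
    rw [pow_succ 3 (2 * k), pow_mul, pow_mul]
    norm_num
    linear_combination h
end

section
/- Fix n ≥ 1. For a string c ∈ {I,H}^n define f_c : {0,1}^n → {0,1,-1} as follows: let P = {j : c_j = H} with increasing enumeration p_0 < p_1 < … < p_{m-1}; for j with c_j = I let q(j) be the least element of P greater than j if one exists and q(j) = n otherwise, with the convention x_n = 0; set f_c(x) = (∏_{j : c_j = I} [x_j = x_{q(j)}]) · (-1)^{∑_{i=0}^{m-2} x_{p_i}·x_{p_{i+1}}}, where [·] equals 1 if the condition holds and 0 otherwise. Let ℬ = { f_c ∘ σ : c ∈ {I,H}^n, σ a permutation of the n coordinates }, where (f_c ∘ σ)(x_0,…,x_{n-1}) = f_c(x_{σ(0)},…,x_{σ(n-1)}).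 Then the cardinality of ℬ is 2^{n-1} + ∑_{k=0}^{n} k!·S(n,k). -/
/-- Stirling numbers of the second kind. -/
def stirling2 : ℕ → ℕ → ℕ
  | 0, 0 => 1
  | 0, _ + 1 => 0
  | _ + 1, 0 => 0
  | n + 1, k + 1 => (k + 1) * stirling2 n (k + 1) + stirling2 n k

/-- The `0/1` value of the bit `x_j`, with the convention `x_n = 0`
(indices `j ≥ n` give `0`). -/
def extBit (n : ℕ) (x : Fin n → Bool) (j : ℕ) : ℕ :=
  if h : j < n then (x ⟨j, h⟩).toNat else 0

/-- The least element of `P` strictly greater than `j`, or `n` if none exists. -/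
def nxt (n : ℕ) (P : Finset ℕ) (j : ℕ) : ℕ :=
  if h : (P.filter fun p => j < p).Nonempty then (P.filter fun p => j < p).min' h else n

/-- The positions of the string `c ∈ {I,H}^n` carrying an `H`
(`c j = true` means `H`, `c j = false` means `I`). -/
def PsetIH (n : ℕ) (c : Fin n → Bool) : Finset ℕ :=
  (Finset.univ.filter fun j => c j = true).image Fin.val

/-- The complementary array `f_c : {0,1}^n → {0,1,-1}` of the paper's
construction seeded by the string `c ∈ {I,H}^n`:
`f_c(x) = (∏_{j : c_j = I} [x_j = x_{q(j)}]) · (-1)^{∑_{i} x_{p_i} x_{p_{i+1}}}`,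
where `p_0 < … < p_{m-1}` enumerates `P = {j : c_j = H}`, `q(j)` is the least
element of `P` greater than `j` (or `n`), and `x_n = 0`.  (The quadratic sum
over consecutive pairs of `P` is expressed as `∑_{j ∈ P} x_j x_{q(j)}`, which
agrees with it since the top term `x_{p_{m-1}} x_n` vanishes.) -/
def fIH (n : ℕ) (c : Fin n → Bool) (x : Fin n → Bool) : ℤ :=
  (∏ j ∈ Finset.univ.filter fun j : Fin n => c j = false,
      if (x j).toNat = extBit n x (nxt n (PsetIH n c) j.val) then 1 else 0) *
    (-1) ^ (∑ j ∈ PsetIH n c, extBit n x j * extBit n x (nxt n (PsetIH n c) j))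

section

open Finset

theorem image_cons {α : Type*} [DecidableEq α] {n : ℕ} (a : α) (g : Fin n → α) :
    univ.image (Fin.cons a g : Fin (n + 1) → α) = insert a (univ.image g) := by
  ext b
  simp [Fin.exists_fin_succ, eq_comm]

theorem insert_eq_iff {α : Type*} [DecidableEq α] {a : α} {s t : Finset α} (ha : a ∈ s) :
    insert a t = s ↔ t = s ∨ t = s.erase a := by
  constructor
  · rintro rfl
    by_cases h : a ∈ t
    · exact Or.inl (insert_eq_of_mem h).symm
    · exact Or.inr (erase_insert h).symm
  · rintro (rfl | rfl)
    · exact insert_eq_of_mem ha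
    · exact insert_erase ha

/-- The number of maps from an `n`-element set onto `s` is `|s|! S(n, |s|)`. -/
theorem card_filter_image_eq {α : Type*} [DecidableEq α] (n : ℕ) (s : Finset α) :
    #{f ∈ Fintype.piFinset fun _ : Fin n => s | univ.image f = s} =
      (#s).factorial * stirling2 n #s := by
  induction n generalizing s with
  | zero =>
    rcases s.eq_empty_or_nonempty with rfl | hs
    · simp [stirling2]
    · obtain ⟨k, hk⟩ := Nat.exists_eq_succ_of_ne_zero hs.card_pos.ne'
      simp [hk, stirling2, hs.ne_empty.symm]
  | succ n ih =>
    rcases s.eq_empty_or_nonempty with rfl | hs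
    · simp [stirling2]
    obtain ⟨k, hk⟩ : ∃ k, #s = k + 1 := Nat.exists_eq_succ_of_ne_zero hs.card_pos.ne'
    have hfib : ∀ a ∈ s,
        #{f ∈ {f ∈ Fintype.piFinset fun _ : Fin (n + 1) => s | univ.image f = s} | f 0 = a} =
          (k + 1).factorial * stirling2 n (k + 1) + k.factorial * stirling2 n k := by
      intro a ha
      have hdisj : Disjoint {f ∈ Fintype.piFinset fun _ : Fin n => s | univ.image f = s}
          {f ∈ Fintype.piFinset fun _ : Fin n => s.erase a | univ.image f = s.erase a} := by
        rw [Finset.disjoint_left]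
        intro f hf hf'
        have h1 := (mem_filter.1 hf).2
        rw [(mem_filter.1 hf').2] at h1
        exact notMem_erase a s (by rwa [h1])
      have hk' : #(s.erase a) = k := by simp [card_erase_of_mem ha, hk]
      have ih₁ := ih s
      have ih₂ := ih (s.erase a)
      rw [hk] at ih₁
      rw [hk'] at ih₂
      rw [← ih₁, ← ih₂, ← card_union_of_disjoint hdisj]
      refine card_bij' (fun f _ => Fin.tail f) (fun g _ => (Fin.cons a g : Fin (n + 1) → α))
        ?_ ?_ ?_ ?_
      · intro f hf
        simp only [mem_filter, Fintype.mem_piFinset] at hf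
        obtain ⟨⟨-, him⟩, rfl⟩ := hf
        rw [← Fin.cons_self_tail f, image_cons, insert_eq_iff ha] at him
        rw [mem_union, mem_filter, mem_filter, Fintype.mem_piFinset, Fintype.mem_piFinset]
        refine him.imp (fun h => ⟨fun i => ?_, h⟩) (fun h => ⟨fun i => ?_, h⟩) <;>
        · rw [← h]; exact mem_image_of_mem _ (mem_univ i)
      · intro g hg
        rw [mem_union, mem_filter, mem_filter] at hg
        have him : univ.image g = s ∨ univ.image g = s.erase a := hg.imp And.right And.right
        have hs' : univ.image (Fin.cons a g : Fin (n + 1) → α) = s := by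
          rw [image_cons, insert_eq_iff ha]
          exact him
        simp only [mem_filter, Fintype.mem_piFinset, Fin.cons_zero, and_true]
        exact ⟨fun i => hs' ▸ mem_image_of_mem _ (mem_univ i), hs'⟩
      · intro f hf
        rw [← (mem_filter.1 hf).2]
        exact Fin.cons_self_tail f
      · intro g _
        exact Fin.tail_cons (α := fun _ => α) a g
    rw [card_eq_sum_card_fiberwise (f := fun f => f 0) (t := s) (by
      intro f hf
      exact (Fintype.mem_piFinset.1 (mem_filter.1 hf).1) 0), sum_congr rfl hfib, sum_const, hk,
      stirling2, Nat.factorial_succ, smul_eq_mul]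
    ring

/-- If the fibres of `φ` on `T` are the sets `{t, ρ t}`, then `φ` takes
`(|T| + |Fix ρ|) / 2` values on `T`. -/
theorem two_mul_card_image {α β : Type*} [DecidableEq α] [DecidableEq β] {T : Finset α}
    {φ : α → β} {ρ : α → α} (hρ : ∀ t ∈ T, ρ t ∈ T)
    (h : ∀ s ∈ T, ∀ t ∈ T, φ s = φ t ↔ s = t ∨ s = ρ t) :
    2 * #(T.image φ) = #T + #{t ∈ T | ρ t = t} := by
  have hmap : Set.MapsTo φ T (T.image φ) := fun t ht => mem_coe.2 (mem_image_of_mem φ ht)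
  rw [card_eq_sum_card_fiberwise hmap, card_eq_sum_card_fiberwise
    (hmap.mono_left (coe_subset.2 (filter_subset (fun t => ρ t = t) T))), ← sum_add_distrib,
    sum_congr rfl (g := fun _ => 2), sum_const, smul_eq_mul, mul_comm]
  intro b hb
  obtain ⟨t, ht, rfl⟩ := mem_image.1 hb
  have hfib : {s ∈ T | φ s = φ t} = {t, ρ t} := by
    ext s
    have := hρ t ht
    have := h s
    simp only [mem_filter, mem_insert, mem_singleton]
    grind
  rw [filter_comm, hfib, filter_insert, filter_singleton]
  by_cases hfix : ρ t = t
  · simp [hfix]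
  · have : ρ (ρ t) ≠ ρ t := by
      have h1 := (h t ht (ρ t) (hρ t ht)).1 ((h (ρ t) (hρ t ht) t ht).2 (Or.inr rfl)).symm
      grind
    rw [if_neg hfix, if_neg this, card_pair (Ne.symm hfix), card_empty]

theorem stirling2_eq_zero_of_lt : ∀ {n k : ℕ}, n < k → stirling2 n k = 0
  | 0, k + 1, _ => rfl
  | n + 1, k + 1, h => by
    rw [stirling2, stirling2_eq_zero_of_lt (by lia : n < k + 1),
      stirling2_eq_zero_of_lt (by lia : n < k), mul_zero]

/-- Every positive number below a value of `w` is a value of `w`. Such a `w` encodes the sequence of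
disjoint nonempty blocks `w⁻¹(1), w⁻¹(2), …` in `Fin n`. -/
def IsLabelling {n : ℕ} (w : Fin n → ℕ) : Prop :=
  ∀ j i, 0 < i → i ≤ w j → ∃ j', w j' = i

open Classical in
/-- The labellings of `Fin n` with values at most `n`. -/
noncomputable def labellings (n : ℕ) : Finset (Fin n → ℕ) :=
  {w ∈ Fintype.piFinset fun _ => range (n + 1) | IsLabelling w}

theorem mem_labellings {n : ℕ} {w : Fin n → ℕ} :
    w ∈ labellings n ↔ (∀ j, w j ≤ n) ∧ IsLabelling w := by
  simp [labellings]

theorem le_sup_label {n : ℕ} (w : Fin n → ℕ) (j : Fin n) : w j ≤ univ.sup w :=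
  le_sup (mem_univ j)

theorem IsLabelling.exists_eq {n : ℕ} {w : Fin n → ℕ} (hw : IsLabelling w) {i : ℕ} (hi : 0 < i)
    (hi' : i ≤ univ.sup w) : ∃ j, w j = i := by
  obtain ⟨j, -, hj⟩ := (Finset.le_sup_iff (show (⊥ : ℕ) < i from hi)).1 hi'
  exact hw j i hi hj

theorem sup_le_of_mem_labellings {n : ℕ} {w : Fin n → ℕ} (hw : w ∈ labellings n) :
    univ.sup w ≤ n :=
  Finset.sup_le fun j _ => (mem_labellings.1 hw).1 j

theorem isLabelling_and_sup_eq_iff {n : ℕ} {w : Fin n → ℕ} {m : ℕ} :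
    IsLabelling w ∧ univ.sup w = m ↔ univ.image w = Icc 1 m ∨ univ.image w = range (m + 1) := by
  constructor
  · rintro ⟨hw, rfl⟩
    by_cases h0 : ∃ j, w j = 0
    · refine Or.inr (Finset.ext fun i => ?_)
      simp only [mem_image, mem_univ, true_and, mem_range]
      constructor
      · rintro ⟨j, rfl⟩
        exact Nat.lt_succ_of_le (le_sup_label w j)
      · intro hi
        rcases Nat.eq_zero_or_pos i with rfl | hpos
        · exact h0
        · exact hw.exists_eq hpos (by lia)
    · refine Or.inl (Finset.ext fun i => ?_)
      simp only [mem_image, mem_univ, true_and, mem_Icc]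
      constructor
      · rintro ⟨j, rfl⟩
        exact ⟨Nat.pos_of_ne_zero fun h => h0 ⟨j, h⟩, le_sup_label w j⟩
      · exact fun hi => hw.exists_eq hi.1 hi.2
  · intro h
    have hmem : ∀ i, (∃ j, w j = i) ↔ i ∈ univ.image w := by simp
    have hle : ∀ j, w j ≤ m := fun j => by
      have := (hmem (w j)).1 ⟨j, rfl⟩
      rcases h with h | h <;> rw [h] at this <;> simp at this <;> lia
    have hex : ∀ i, 0 < i → i ≤ m → ∃ j, w j = i := fun i hi him => by
      rw [hmem]
      rcases h with h | h <;> rw [h] <;> simp <;> lia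
    refine ⟨fun j i hi hij => hex i hi (hij.trans (hle j)), ?_⟩
    refine le_antisymm (Finset.sup_le fun j _ => hle j) ?_
    rcases Nat.eq_zero_or_pos m with rfl | hm
    · exact Nat.zero_le _
    · obtain ⟨j, hj⟩ := hex m hm le_rfl
      exact hj ▸ le_sup_label w j

theorem card_labellings {n : ℕ} (hn : 1 ≤ n) :
    #(labellings n) = 2 * ∑ k ∈ range (n + 1), k.factorial * stirling2 n k := by
  have hfib : ∀ m ∈ range (n + 1), #{w ∈ labellings n | univ.sup w = m} =
      m.factorial * stirling2 n m + (m + 1).factorial * stirling2 n (m + 1) := by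
    intro m hm
    have h₁ := card_filter_image_eq n (Icc 1 m)
    have h₂ := card_filter_image_eq n (range (m + 1))
    rw [Nat.card_Icc, Nat.add_sub_cancel] at h₁
    rw [card_range] at h₂
    rw [← h₁, ← h₂, ← card_union_of_disjoint]
    · congr 1
      ext w
      have := isLabelling_and_sup_eq_iff (w := w) (m := m)
      have hle := le_sup_label w
      have hmem : ∀ j, w j ∈ univ.image w := fun j => mem_image_of_mem _ (mem_univ j)
      simp only [mem_filter, mem_labellings, mem_union, Fintype.mem_piFinset, and_assoc, this]
      constructor
      · rintro ⟨-, h | h⟩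
        · exact Or.inl ⟨fun j => h ▸ hmem j, h⟩
        · exact Or.inr ⟨fun j => h ▸ hmem j, h⟩
      · intro h
        have h' := h.imp And.right And.right
        refine ⟨fun j => ?_, h'⟩
        have := (this.2 h').2
        have := hle j
        have := mem_range.1 hm
        lia
    · rw [Finset.disjoint_left]
      intro w hw hw'
      have h := (mem_filter.1 hw).2.symm.trans (mem_filter.1 hw').2
      have h0 : 0 ∈ range (m + 1) := by simp
      rw [← h] at h0
      simp at h0
  have hmap : Set.MapsTo (fun w : Fin n → ℕ => univ.sup w) (labellings n) (range (n + 1)) :=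
    fun w hw => mem_coe.2 (mem_range.2 (Nat.lt_succ_of_le (sup_le_of_mem_labellings hw)))
  rw [card_eq_sum_card_fiberwise hmap, sum_congr rfl hfib, sum_add_distrib, two_mul]
  congr 1
  have h := sum_range_succ' (fun k => k.factorial * stirling2 n k) (n + 1)
  rw [sum_range_succ, stirling2_eq_zero_of_lt (Nat.lt_succ_self n)] at h
  obtain ⟨k, rfl⟩ := Nat.exists_eq_add_of_le' hn
  simpa [stirling2] using h.symm

/-- The labelling with the order of the blocks reversed. -/
def reverseLabels {n : ℕ} (w : Fin n → ℕ) (j : Fin n) : ℕ :=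
  if w j = 0 then 0 else univ.sup w + 1 - w j

theorem reverseLabels_mem {n : ℕ} {w : Fin n → ℕ} (hw : w ∈ labellings n) :
    reverseLabels w ∈ labellings n := by
  have hsup := sup_le_of_mem_labellings hw
  have hle := le_sup_label w
  refine mem_labellings.2 ⟨fun j => ?_, fun j i hi hij => ?_⟩
  · unfold reverseLabels
    split_ifs <;> lia
  · have hi' : i ≤ univ.sup w := by
      unfold reverseLabels at hij
      split_ifs at hij <;> lia
    obtain ⟨j', hj'⟩ :=
      (mem_labellings.1 hw).2.exists_eq (i := univ.sup w + 1 - i) (by lia) (by lia)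
    refine ⟨j', ?_⟩
    rw [reverseLabels, hj', if_neg (by lia)]
    lia

theorem reverseLabels_eq_self_iff {n : ℕ} {w : Fin n → ℕ} (hw : IsLabelling w) :
    reverseLabels w = w ↔ ∀ j, w j ≤ 1 := by
  have hle := le_sup_label w
  rw [funext_iff]
  constructor
  · intro h j
    by_contra! hj
    obtain ⟨j', hj'⟩ := hw j 1 one_pos hj.le
    have h1 := h j'
    rw [reverseLabels, hj', if_neg one_ne_zero] at h1
    have := hle j
    lia
  · intro h j
    have hsup : univ.sup w ≤ 1 := Finset.sup_le fun j _ => h j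
    have := h j
    have := hle j
    unfold reverseLabels
    split_ifs <;> lia

theorem card_filter_reverseLabels_eq {n : ℕ} (hn : 1 ≤ n) :
    #{w ∈ labellings n | reverseLabels w = w} = 2 ^ n := by
  have : {w ∈ labellings n | reverseLabels w = w} = Fintype.piFinset fun _ : Fin n => range 2 := by
    ext w
    simp only [mem_filter, Fintype.mem_piFinset, mem_range, Nat.lt_succ_iff]
    constructor
    · rintro ⟨hw, h⟩
      exact (reverseLabels_eq_self_iff (mem_labellings.1 hw).2).1 h
    · intro h
      have hw : IsLabelling w := fun j i hi hij => ⟨j, by have := h j; lia⟩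
      exact ⟨mem_labellings.2 ⟨fun j => (h j).trans hn, hw⟩, (reverseLabels_eq_self_iff hw).2 h⟩
  rw [this, Fintype.card_piFinset]
  simp

/-- `x` vanishes on the block labelled `0` and is constant on every block. -/
def IsCompatible {n : ℕ} (w : Fin n → ℕ) (x : Fin n → Bool) : Prop :=
  (∀ j, w j = 0 → x j = false) ∧ ∀ j k, w j = w k → x j = x k

/-- The common value of `x` on the block labelled `i`. -/
def blockBit {n : ℕ} (w : Fin n → ℕ) (x : Fin n → Bool) (i : ℕ) : ℕ :=
  if ∃ j, w j = i ∧ x j = true then 1 else 0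

open Classical in
/-- The array whose support consists of the points compatible with `w`, with sign given by
the quadratic form of the path on the blocks. -/
noncomputable def labelArray {n : ℕ} (w : Fin n → ℕ) (x : Fin n → Bool) : ℤ :=
  if IsCompatible w x then (-1) ^ ∑ i ∈ range n, blockBit w x i * blockBit w x (i + 1) else 0

theorem labelArray_ne_zero_iff {n : ℕ} {w : Fin n → ℕ} {x : Fin n → Bool} :
    labelArray w x ≠ 0 ↔ IsCompatible w x := by
  simp [labelArray]

theorem labelArray_comp_perm {n : ℕ} (w : Fin n → ℕ) (x : Fin n → Bool) (σ : Equiv.Perm (Fin n)) :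
    labelArray (w ∘ σ) (x ∘ σ) = labelArray w x := by
  have hc : IsCompatible (w ∘ σ) (x ∘ σ) ↔ IsCompatible w x := by
    refine and_congr (σ.forall_congr_right (q := fun j => w j = 0 → x j = false)) ⟨?_, ?_⟩
    · intro h j j'
      simpa using h (σ.symm j) (σ.symm j')
    · exact fun h j j' => h (σ j) (σ j')
  have hb : blockBit (w ∘ σ) (x ∘ σ) = blockBit w x := by
    funext i
    have := σ.exists_congr_right (q := fun j => w j = i ∧ x j = true)
    simp only [blockBit, Function.comp_apply, this]
  classical
  rw [labelArray, labelArray, hb]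
  exact if_congr hc rfl rfl

theorem blockBit_zero {n : ℕ} {w : Fin n → ℕ} {x : Fin n → Bool} (h : IsCompatible w x) :
    blockBit w x 0 = 0 := by
  refine if_neg ?_
  rintro ⟨j, hj, hx⟩
  simp [h.1 j hj] at hx

theorem blockBit_eq_zero {n : ℕ} {w : Fin n → ℕ} {x : Fin n → Bool} {i : ℕ}
    (h : ∀ j, w j < i) : blockBit w x i = 0 :=
  if_neg fun ⟨j, hj, _⟩ => (h j).ne hj

theorem blockBit_apply {n : ℕ} {w : Fin n → ℕ} {x : Fin n → Bool} (h : IsCompatible w x)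
    (j : Fin n) : blockBit w x (w j) = (x j).toNat := by
  have : (∃ j', w j' = w j ∧ x j' = true) ↔ x j = true :=
    ⟨fun ⟨j', hj', hx⟩ => h.2 j' j hj' ▸ hx, fun hx => ⟨j, rfl, hx⟩⟩
  simp only [blockBit, this]
  cases x j <;> rfl

theorem sum_blockBit_eq {n : ℕ} {w : Fin n → ℕ} {x : Fin n → Bool} (h : IsCompatible w x)
    (hw : univ.sup w ≤ n) :
    ∑ i ∈ range n, blockBit w x i * blockBit w x (i + 1) =
      ∑ i ∈ Ico 1 (univ.sup w), blockBit w x i * blockBit w x (i + 1) := by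
  symm
  refine sum_subset (fun i hi => by rw [mem_Ico] at hi; rw [mem_range]; lia) fun i _ hi' => ?_
  rcases Nat.eq_zero_or_pos i with rfl | hpos
  · rw [blockBit_zero h, zero_mul]
  · rw [blockBit_eq_zero (i := i + 1), mul_zero]
    intro j
    have := le_sup_label w j
    rw [mem_Ico] at hi'
    lia

theorem isCompatible_reverseLabels_iff {n : ℕ} {w : Fin n → ℕ} {x : Fin n → Bool} :
    IsCompatible (reverseLabels w) x ↔ IsCompatible w x := by
  have hle := le_sup_label w
  have h0 : ∀ j, reverseLabels w j = 0 ↔ w j = 0 := fun j => by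
    have := hle j
    unfold reverseLabels
    split_ifs <;> lia
  have heq : ∀ j j', reverseLabels w j = reverseLabels w j' ↔ w j = w j' := fun j j' => by
    have := hle j
    have := hle j'
    unfold reverseLabels
    split_ifs <;> lia
  simp only [IsCompatible, h0, heq]

theorem blockBit_reverseLabels {n : ℕ} {w : Fin n → ℕ} {x : Fin n → Bool} {i : ℕ} (hi : 0 < i)
    (hi' : i ≤ univ.sup w) :
    blockBit (reverseLabels w) x i = blockBit w x (univ.sup w + 1 - i) := by
  have heq : ∀ j, reverseLabels w j = i ↔ w j = univ.sup w + 1 - i := fun j => by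
    have := le_sup_label w j
    unfold reverseLabels
    split_ifs <;> lia
  simp only [blockBit, heq]

theorem sup_reverseLabels {n : ℕ} {w : Fin n → ℕ} (hw : IsLabelling w) :
    univ.sup (reverseLabels w) = univ.sup w := by
  refine le_antisymm (Finset.sup_le fun j _ => ?_) ?_
  · unfold reverseLabels
    split_ifs <;> lia
  · rcases Nat.eq_zero_or_pos (univ.sup w) with h | h
    · exact h ▸ Nat.zero_le _
    · obtain ⟨j, hj⟩ := hw.exists_eq one_pos h
      have := le_sup_label (reverseLabels w) j
      rwa [reverseLabels, hj, if_neg one_ne_zero, Nat.add_sub_cancel] at this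

theorem labelArray_reverseLabels {n : ℕ} {w : Fin n → ℕ} (hw : w ∈ labellings n) :
    labelArray (reverseLabels w) = labelArray w := by
  funext x
  by_cases h : IsCompatible w x
  · have h' := isCompatible_reverseLabels_iff.2 h
    rw [labelArray, labelArray, if_pos h, if_pos h', sum_blockBit_eq h (sup_le_of_mem_labellings hw),
      sum_blockBit_eq h' (sup_le_of_mem_labellings (reverseLabels_mem hw)),
      sup_reverseLabels (mem_labellings.1 hw).2]
    congr 1
    refine sum_nbij' (fun i => univ.sup w - i) (fun i => univ.sup w - i) ?_ ?_ ?_ ?_ ?_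
    all_goals
      intro i hi
      rw [mem_Ico] at hi
    · rw [mem_Ico]
      lia
    · rw [mem_Ico]
      lia
    · lia
    · lia
    · rw [blockBit_reverseLabels hi.1 hi.2.le, blockBit_reverseLabels (by lia) (by lia), mul_comm,
        show univ.sup w + 1 - (i + 1) = univ.sup w - i by lia,
        show univ.sup w + 1 - i = univ.sup w - i + 1 by lia]
  · rw [labelArray, labelArray, if_neg h, if_neg (isCompatible_reverseLabels_iff.not.2 h)]

theorem isCompatible_indicator {n : ℕ} (w : Fin n → ℕ) {A : Finset ℕ} (hA : 0 ∉ A) :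
    IsCompatible w fun j => decide (w j ∈ A) :=
  ⟨fun j hj => by simpa [hj] using hA, fun j j' h => by simp only [h]⟩

theorem blockBit_indicator {n : ℕ} {w : Fin n → ℕ} {A : Finset ℕ} (hA : ∀ i ∈ A, ∃ j, w j = i)
    (i : ℕ) : blockBit w (fun j => decide (w j ∈ A)) i = if i ∈ A then 1 else 0 := by
  have : (∃ j, w j = i ∧ decide (w j ∈ A) = true) ↔ i ∈ A := by
    constructor
    · rintro ⟨j, rfl, h⟩
      exact of_decide_eq_true h
    · intro h
      obtain ⟨j, rfl⟩ := hA i h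
      exact ⟨j, rfl, decide_eq_true h⟩
  simp only [blockBit, this]

theorem labelArray_indicator {n : ℕ} {w : Fin n → ℕ} {A : Finset ℕ} (hA : ∀ i ∈ A, ∃ j, w j = i)
    (hA0 : 0 ∉ A) : labelArray w (fun j => decide (w j ∈ A)) =
      (-1) ^ #{i ∈ range n | i ∈ A ∧ i + 1 ∈ A} := by
  rw [labelArray, if_pos (isCompatible_indicator w hA0), card_filter]
  congr 1
  refine sum_congr rfl fun i _ => ?_
  rw [blockBit_indicator hA, blockBit_indicator hA]
  split_ifs <;> simp_all

theorem eq_zero_of_isCompatible_imp {n : ℕ} {w w' : Fin n → ℕ}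
    (h : ∀ x, IsCompatible w x → IsCompatible w' x) {j : Fin n} (hj : w' j = 0) : w j = 0 := by
  by_contra hne
  have := (h _ (isCompatible_indicator w (A := {w j}) (by simpa using Ne.symm hne))).1 j hj
  simp at this

theorem eq_of_isCompatible_imp {n : ℕ} {w w' : Fin n → ℕ}
    (h : ∀ x, IsCompatible w x → IsCompatible w' x) {j j' : Fin n} (hj : w' j = w' j') :
    w j = w j' := by
  have key : ∀ a b, w' a = w' b → w a ≠ 0 → w a = w b := fun a b hab hne => by
    have := (h _ (isCompatible_indicator w (A := {w a}) (by simpa using Ne.symm hne))).2 a b hab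
    simpa [eq_comm] using this
  by_cases h0 : w j = 0
  · by_contra hne
    exact hne (key j' j hj.symm (by rw [h0] at hne; exact Ne.symm hne)).symm
  · exact key j j' hj h0

theorem adjacent_of_labelArray_eq {n : ℕ} {w w' : Fin n → ℕ} (hw : ∀ j, w j ≤ n)
    (h : labelArray w = labelArray w') {j j' : Fin n} (hj : w j ≠ 0) (hjj' : w j + 1 = w j') :
    w' j + 1 = w' j' ∨ w' j' + 1 = w' j := by
  have hc : ∀ x, IsCompatible w x ↔ IsCompatible w' x := fun x => by
    rw [← labelArray_ne_zero_iff, h, labelArray_ne_zero_iff]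
  have heq : ∀ a b, w a = w b ↔ w' a = w' b := fun a b =>
    ⟨eq_of_isCompatible_imp fun x => (hc x).2, eq_of_isCompatible_imp fun x => (hc x).1⟩
  have hzero : ∀ a, w' a = 0 → w a = 0 := fun a =>
    eq_zero_of_isCompatible_imp fun x => (hc x).1
  have hx : (fun a => decide (w a ∈ ({w j, w j'} : Finset ℕ))) =
      fun a => decide (w' a ∈ ({w' j, w' j'} : Finset ℕ)) := by
    funext a
    simp only [mem_insert, mem_singleton, heq]
  have h₁ := congrFun h fun a => decide (w a ∈ ({w j, w j'} : Finset ℕ))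
  nth_rw 2 [hx] at h₁
  have hj' : w j' ≠ 0 := by lia
  have hwj : w' j ≠ 0 := fun h0 => hj (hzero j h0)
  have hwj' : w' j' ≠ 0 := fun h0 => hj' (hzero j' h0)
  rw [labelArray_indicator (by simp) (by simp [Ne.symm hj, Ne.symm hj']),
    labelArray_indicator (by simp) (by simp [Ne.symm hwj, Ne.symm hwj'])] at h₁
  have hone : {i ∈ range n | i ∈ ({w j, w j'} : Finset ℕ) ∧ i + 1 ∈ ({w j, w j'} : Finset ℕ)} =
      {w j} := by
    ext i
    have := hw j'
    simp only [mem_filter, mem_range, mem_insert, mem_singleton]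
    lia
  by_contra hnot
  have hnone : {i ∈ range n | i ∈ ({w' j, w' j'} : Finset ℕ) ∧
      i + 1 ∈ ({w' j, w' j'} : Finset ℕ)} = ∅ := by
    ext i
    simp only [mem_filter, mem_range, mem_insert, mem_singleton, notMem_empty, iff_false]
    lia
  rw [hone, hnone] at h₁
  simp at h₁

/-- An injective self-map of the path `1, …, m` preserving adjacency is the identity or
the reflection. -/
theorem eq_self_or_eq_reflect {m : ℕ} {π : ℕ → ℕ} (hmap : ∀ i ∈ Icc 1 m, π i ∈ Icc 1 m)
    (hinj : Set.InjOn π (Icc 1 m : Finset ℕ))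
    (hadj : ∀ i, 1 ≤ i → i < m → π i + 1 = π (i + 1) ∨ π (i + 1) + 1 = π i) :
    (∀ i ∈ Icc 1 m, π i = i) ∨ ∀ i ∈ Icc 1 m, π i = m + 1 - i := by
  simp only [mem_Icc] at hmap ⊢
  have hne : ∀ i, 1 ≤ i → i + 1 < m → π i ≠ π (i + 2) := fun i hi him h => by
    have := hinj (by simp; lia) (by simp; lia) h
    lia
  rcases Nat.lt_or_ge m 2 with hm | hm
  · left
    intro i hi
    have := hmap i hi
    lia
  rcases hadj 1 le_rfl hm with h1 | h1
  · have hstep : ∀ i, 1 ≤ i → i < m → π i + 1 = π (i + 1) := by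
      intro i hi
      induction i, hi using Nat.le_induction with
      | base => exact fun _ => h1
      | succ i hi ih =>
        intro him
        have := ih (by lia)
        have := hne i hi him
        have := hadj (i + 1) (by lia) him
        lia
    have hlin : ∀ i, 1 ≤ i → i ≤ m → π i + 1 = π 1 + i := by
      intro i hi
      induction i, hi using Nat.le_induction with
      | base => exact fun _ => rfl
      | succ i hi ih =>
        intro him
        have := ih (by lia)
        have := hstep i hi him
        lia
    left
    intro i hi
    have := hlin i hi.1 hi.2
    have := hlin m (by lia) le_rfl
    have := hmap m (by lia)
    have := hmap 1 (by lia)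
    lia
  · have hstep : ∀ i, 1 ≤ i → i < m → π (i + 1) + 1 = π i := by
      intro i hi
      induction i, hi using Nat.le_induction with
      | base => exact fun _ => h1
      | succ i hi ih =>
        intro him
        have := ih (by lia)
        have := hne i hi him
        have := hadj (i + 1) (by lia) him
        lia
    have hlin : ∀ i, 1 ≤ i → i ≤ m → π i + i = π 1 + 1 := by
      intro i hi
      induction i, hi using Nat.le_induction with
      | base => exact fun _ => rfl
      | succ i hi ih =>
        intro him
        have := ih (by lia)
        have := hstep i hi him
        lia
    right
    intro i hi
    have := hlin i hi.1 hi.2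
    have := hlin m (by lia) le_rfl
    have := hmap m (by lia)
    have := hmap 1 (by lia)
    lia

theorem sup_le_sup_of_isCompatible_iff {n : ℕ} {w w' : Fin n → ℕ} (hw : IsLabelling w)
    (hc : ∀ x, IsCompatible w x ↔ IsCompatible w' x) : univ.sup w ≤ univ.sup w' := by
  have hex : ∀ i : ℕ, ∃ k, i ∈ Icc 1 (univ.sup w) → ∃ j, w j = i ∧ w' j = k := fun i => by
    by_cases hi : i ∈ Icc 1 (univ.sup w)
    · obtain ⟨j, hj⟩ := hw.exists_eq (mem_Icc.1 hi).1 (mem_Icc.1 hi).2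
      exact ⟨w' j, fun _ => ⟨j, hj, rfl⟩⟩
    · exact ⟨0, fun h => absurd h hi⟩
  choose π hπ using hex
  have := card_le_card_of_injOn (s := Icc 1 (univ.sup w)) (t := Icc 1 (univ.sup w')) π ?_ ?_
  · simpa using this
  · intro i hi
    obtain ⟨j, rfl, hj⟩ := hπ i hi
    have hpos : w' j ≠ 0 := fun h0 => by
      have := eq_zero_of_isCompatible_imp (fun x => (hc x).1) h0
      simp [this] at hi
    rw [← hj]
    exact mem_coe.2 (mem_Icc.2 ⟨Nat.pos_of_ne_zero hpos, le_sup_label w' j⟩)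
  · intro i hi i' hi' h
    obtain ⟨j, rfl, hj⟩ := hπ i hi
    obtain ⟨j', rfl, hj'⟩ := hπ i' hi'
    exact eq_of_isCompatible_imp (fun x => (hc x).1) (hj.trans (h.trans hj'.symm))

theorem labelArray_eq_iff {n : ℕ} {w w' : Fin n → ℕ} (hw : w ∈ labellings n)
    (hw' : w' ∈ labellings n) :
    labelArray w' = labelArray w ↔ w' = w ∨ w' = reverseLabels w := by
  constructor
  swap
  · rintro (rfl | rfl)
    · rfl
    · exact labelArray_reverseLabels hw
  intro h
  have hl := (mem_labellings.1 hw).2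
  have hc : ∀ x, IsCompatible w x ↔ IsCompatible w' x := fun x => by
    rw [← labelArray_ne_zero_iff, ← h, labelArray_ne_zero_iff]
  have heq : ∀ a b, w a = w b ↔ w' a = w' b := fun a b =>
    ⟨eq_of_isCompatible_imp fun x => (hc x).2, eq_of_isCompatible_imp fun x => (hc x).1⟩
  have hzero : ∀ a, w a = 0 ↔ w' a = 0 := fun a =>
    ⟨eq_zero_of_isCompatible_imp fun x => (hc x).2, eq_zero_of_isCompatible_imp fun x => (hc x).1⟩
  have hsup : univ.sup w' = univ.sup w :=
    le_antisymm (sup_le_sup_of_isCompatible_iff (mem_labellings.1 hw').2 fun x => (hc x).symm)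
      (sup_le_sup_of_isCompatible_iff hl hc)
  have hex : ∀ i : ℕ, ∃ k, ∀ j, w j = i → w' j = k := fun i => by
    by_cases hi : ∃ j, w j = i
    · obtain ⟨j, rfl⟩ := hi
      exact ⟨w' j, fun j' hj' => (heq j' j).1 hj'⟩
    · exact ⟨0, fun j hj => absurd ⟨j, hj⟩ hi⟩
  choose π hπ' using hex
  have hπ : ∀ j, π (w j) = w' j := fun j => (hπ' _ j rfl).symm
  have hsurj : ∀ i ∈ Icc 1 (univ.sup w), ∃ j, w j = i := fun i hi =>
    hl.exists_eq (mem_Icc.1 hi).1 (mem_Icc.1 hi).2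
  have hmemw : ∀ j, w j ≠ 0 → w j ∈ Icc 1 (univ.sup w) := fun j hj =>
    mem_Icc.2 ⟨Nat.pos_of_ne_zero hj, le_sup_label w j⟩
  refine (eq_self_or_eq_reflect (m := univ.sup w) (π := π) ?_ ?_ ?_).imp ?_ ?_
  · intro i hi
    obtain ⟨j, rfl⟩ := hsurj i hi
    rw [hπ, ← hsup, mem_Icc]
    refine ⟨Nat.pos_of_ne_zero fun h0 => ?_, le_sup_label w' j⟩
    rw [(hzero j).2 h0] at hi
    simp at hi
  · intro i hi i' hi' hii'
    obtain ⟨j, rfl⟩ := hsurj i hi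
    obtain ⟨j', rfl⟩ := hsurj i' hi'
    rwa [hπ, hπ, ← heq] at hii'
  · intro i hi him
    obtain ⟨j, hj⟩ := hsurj i (mem_Icc.2 ⟨hi, him.le⟩)
    obtain ⟨j', hj'⟩ := hsurj (i + 1) (mem_Icc.2 ⟨by lia, him⟩)
    rw [← hj', ← hj, hπ, hπ]
    exact adjacent_of_labelArray_eq (mem_labellings.1 hw).1 h.symm (by lia) (by lia)
  · intro hid
    funext j
    by_cases h0 : w j = 0
    · rw [h0, (hzero j).1 h0]
    · rw [← hπ, hid _ (hmemw j h0)]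
  · intro hrefl
    funext j
    by_cases h0 : w j = 0
    · rw [reverseLabels, if_pos h0, (hzero j).1 h0]
    · rw [reverseLabels, if_neg h0, ← hπ, hrefl _ (hmemw j h0)]

theorem mem_PsetIH {n : ℕ} {c : Fin n → Bool} {i : ℕ} :
    i ∈ PsetIH n c ↔ ∃ h : i < n, c ⟨i, h⟩ = true := by
  simp only [PsetIH, mem_image, mem_filter, mem_univ, true_and]
  exact ⟨fun ⟨j, hj, hi⟩ => hi ▸ ⟨j.2, hj⟩, fun ⟨h, hc⟩ => ⟨⟨i, h⟩, hc, rfl⟩⟩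

theorem lt_of_mem_PsetIH {n : ℕ} {c : Fin n → Bool} {i : ℕ} (h : i ∈ PsetIH n c) : i < n :=
  (mem_PsetIH.1 h).1

/-- The number of `p ∈ P` with `i ≤ p`. -/
def countGE (P : Finset ℕ) (i : ℕ) : ℕ := #{p ∈ P | i ≤ p}

theorem countGE_eq_add (P : Finset ℕ) (i : ℕ) :
    countGE P i = countGE P (i + 1) + if i ∈ P then 1 else 0 := by
  have h : {p ∈ P | i ≤ p} = {p ∈ P | i + 1 ≤ p} ∪ {p ∈ P | p = i} := by
    ext p
    simp only [mem_union, mem_filter]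
    grind
  have hd : Disjoint {p ∈ P | i + 1 ≤ p} {p ∈ P | p = i} := by
    rw [Finset.disjoint_left]
    intro p
    simp only [mem_filter]
    grind
  rw [countGE, countGE, h, card_union_of_disjoint hd, filter_eq']
  split_ifs <;> simp

theorem countGE_le_card (P : Finset ℕ) (i : ℕ) : countGE P i ≤ #P :=
  card_filter_le _ _

theorem countGE_antitone (P : Finset ℕ) : Antitone (countGE P) := fun _ _ hij =>
  card_le_card (monotone_filter_right P fun _ _ h => hij.trans h)

theorem countGE_lt_of_mem {P : Finset ℕ} {a b : ℕ} (ha : a ∈ P) (hab : a < b) :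
    countGE P b < countGE P a := by
  have := countGE_antitone P (show a + 1 ≤ b from hab)
  rw [countGE_eq_add P a, if_pos ha]
  lia

theorem countGE_eq_zero {P : Finset ℕ} {i : ℕ} (h : ∀ p ∈ P, p < i) : countGE P i = 0 := by
  rw [countGE, card_eq_zero, filter_eq_empty_iff]
  exact fun p hp => not_le.2 (h p hp)

theorem countGE_succ_injOn (P : Finset ℕ) : Set.InjOn (fun p => countGE P (p + 1)) P := by
  intro a ha b hb hab
  have ha' := countGE_eq_add P a
  have hb' := countGE_eq_add P b
  rw [if_pos (mem_coe.1 ha)] at ha'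
  rw [if_pos (mem_coe.1 hb)] at hb'
  dsimp only at hab
  rcases lt_trichotomy a b with h | h | h
  · have := countGE_lt_of_mem ha h
    lia
  · exact h
  · have := countGE_lt_of_mem hb h
    lia

theorem image_countGE_succ (P : Finset ℕ) :
    P.image (fun p => countGE P (p + 1)) = range #P := by
  have hlt : ∀ p ∈ P, countGE P (p + 1) < #P := fun p hp =>
    (countGE_lt_of_mem hp p.lt_succ_self).trans_le (countGE_le_card P p)
  refine eq_of_subset_of_card_le (image_subset_iff.2 fun p hp => mem_range.2 (hlt p hp)) ?_
  rw [card_range, card_image_of_injOn (countGE_succ_injOn P)]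

theorem nxt_mem_or_eq (n : ℕ) (P : Finset ℕ) (j : ℕ) : nxt n P j ∈ P ∨ nxt n P j = n := by
  unfold nxt
  split_ifs with h
  · exact Or.inl (mem_filter.1 (min'_mem _ h)).1
  · exact Or.inr rfl

theorem countGE_nxt {n : ℕ} {P : Finset ℕ} (hP : ∀ p ∈ P, p < n) (j : ℕ) :
    countGE P (nxt n P j) = countGE P (j + 1) := by
  unfold nxt
  split_ifs with h
  · unfold countGE
    congr 1
    refine filter_congr fun p hp => ⟨fun hle => ?_, fun hle => ?_⟩
    · exact lt_of_lt_of_le (mem_filter.1 (min'_mem _ h)).2 hle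
    · exact min'_le _ _ (mem_filter.2 ⟨hp, hle⟩)
  · rw [countGE_eq_zero hP, countGE_eq_zero]
    intro p hp
    by_contra! hjp
    exact h ⟨p, mem_filter.2 ⟨hp, hjp⟩⟩

/-- `countGE P` is injective on `P ∪ {n}`. -/
theorem eq_of_countGE_eq {n : ℕ} {P : Finset ℕ} (hP : ∀ p ∈ P, p < n) {a b : ℕ}
    (ha : a ∈ P ∨ a = n) (hb : b ∈ P ∨ b = n) (h : countGE P a = countGE P b) : a = b := by
  rcases lt_trichotomy a b with hab | hab | hab
  · rcases ha with ha | rfl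
    · exact absurd h (countGE_lt_of_mem ha hab).ne'
    · rcases hb with hb | rfl
      · exact absurd hab (hP b hb).not_gt
      · rfl
  · exact hab
  · rcases hb with hb | rfl
    · exact absurd h (countGE_lt_of_mem hb hab).ne
    · rcases ha with ha | rfl
      · exact absurd hab (hP a ha).not_gt
      · rfl

/-- The labelling underlying `fIH n c`: each block consists of an `H` and the `I`s directly
before it, and blocks are numbered from the right; the trailing `I`s are labelled `0`. -/
def labelIH (n : ℕ) (c : Fin n → Bool) (j : Fin n) : ℕ := countGE (PsetIH n c) j

theorem isLabelling_labelIH (n : ℕ) (c : Fin n → Bool) : IsLabelling (labelIH n c) := by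
  intro j i hi hij
  have hmem : i - 1 ∈ (PsetIH n c).image fun p => countGE (PsetIH n c) (p + 1) := by
    have := hij.trans (countGE_le_card _ _)
    rw [image_countGE_succ, mem_range]
    lia
  obtain ⟨p, hp, hpi⟩ := mem_image.1 hmem
  refine ⟨⟨p, lt_of_mem_PsetIH hp⟩, ?_⟩
  rw [labelIH, countGE_eq_add, if_pos hp, hpi]
  lia

theorem card_PsetIH_le (n : ℕ) (c : Fin n → Bool) : #(PsetIH n c) ≤ n := by
  have : PsetIH n c ⊆ range n := fun i hi => mem_range.2 (lt_of_mem_PsetIH hi)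
  simpa using card_le_card this

theorem labelIH_mem (n : ℕ) (c : Fin n → Bool) : labelIH n c ∈ labellings n :=
  mem_labellings.2 ⟨fun _ => (countGE_le_card _ _).trans (card_PsetIH_le n c),
    isLabelling_labelIH n c⟩

theorem extBit_eq_blockBit {n : ℕ} {c x : Fin n → Bool} (h : IsCompatible (labelIH n c) x) (q : ℕ) :
    extBit n x q = blockBit (labelIH n c) x (countGE (PsetIH n c) q) := by
  unfold extBit
  split_ifs with hq
  · exact (blockBit_apply h ⟨q, hq⟩).symm
  · rw [countGE_eq_zero fun p hp => (lt_of_mem_PsetIH hp).trans_le (not_lt.1 hq), blockBit_zero h]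

theorem isCompatible_labelIH_iff {n : ℕ} {c x : Fin n → Bool} :
    IsCompatible (labelIH n c) x ↔
      ∀ j, c j = false → (x j).toNat = extBit n x (nxt n (PsetIH n c) j.val) := by
  have hP : ∀ p ∈ PsetIH n c, p < n := fun p => lt_of_mem_PsetIH
  have hmem : ∀ j : Fin n, j.val ∈ PsetIH n c ↔ c j = true := fun j => by
    simp [mem_PsetIH]
  constructor
  · intro h j hj
    rw [extBit_eq_blockBit h, countGE_nxt hP, ← blockBit_apply h, labelIH, countGE_eq_add,
      if_neg (by simp [hmem, hj]), add_zero]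
  · intro h
    have key : ∀ j : Fin n, ∃ q, (q ∈ PsetIH n c ∨ q = n) ∧
        countGE (PsetIH n c) q = labelIH n c j ∧ (x j).toNat = extBit n x q := by
      intro j
      by_cases hj : c j = true
      · exact ⟨j, Or.inl ((hmem j).2 hj), rfl, by simp [extBit]⟩
      · refine ⟨nxt n (PsetIH n c) j, nxt_mem_or_eq _ _ _, ?_, h j (by simpa using hj)⟩
        rw [countGE_nxt hP, labelIH, countGE_eq_add _ j.val, if_neg (by simpa [hmem] using hj),
          add_zero]
    constructor
    · intro j hj
      obtain ⟨q, hq, hqj, hx⟩ := key j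
      have hqn := eq_of_countGE_eq hP hq (Or.inr rfl)
        (hqj.trans (hj.trans (countGE_eq_zero hP).symm))
      simpa [hqn, extBit] using hx
    · intro j j' hjj'
      obtain ⟨q, hq, hqj, hx⟩ := key j
      obtain ⟨q', hq', hqj', hx'⟩ := key j'
      have hqq := eq_of_countGE_eq hP hq hq' (hqj.trans (hjj'.trans hqj'.symm))
      rw [hqq, ← hx'] at hx
      revert hx
      cases x j <;> cases x j' <;> simp

theorem fIH_eq_labelArray (n : ℕ) (c : Fin n → Bool) : fIH n c = labelArray (labelIH n c) := by
  funext x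
  rw [fIH, prod_ite_zero, prod_const_one]
  by_cases h : IsCompatible (labelIH n c) x
  · have h' := isCompatible_labelIH_iff.1 h
    have hI : ∀ j ∈ ({j | c j = false} : Finset (Fin n)),
        (x j).toNat = extBit n x (nxt n (PsetIH n c) j.val) := fun j hj => h' j (mem_filter.1 hj).2
    rw [if_pos hI, one_mul, labelArray, if_pos h]
    congr 1
    have hP : ∀ p ∈ PsetIH n c, p < n := fun p => lt_of_mem_PsetIH
    set F : ℕ → ℕ := fun i => blockBit (labelIH n c) x i * blockBit (labelIH n c) x (i + 1) with hF
    calc _ = ∑ j ∈ PsetIH n c, F (countGE (PsetIH n c) (j + 1)) := by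
          refine sum_congr rfl fun j hj => ?_
          rw [extBit_eq_blockBit h, extBit_eq_blockBit h, countGE_nxt hP, countGE_eq_add _ j,
            if_pos hj, mul_comm]
      _ = ∑ i ∈ range #(PsetIH n c), F i := by
          rw [← image_countGE_succ, sum_image (countGE_succ_injOn _)]
      _ = ∑ i ∈ range n, F i := by
          refine sum_subset (range_subset_range.2 (card_PsetIH_le n c)) fun i _ hi => ?_
          rw [hF]
          dsimp only
          rw [blockBit_eq_zero (i := i + 1), mul_zero]
          intro j
          rw [mem_range, not_lt] at hi
          exact Nat.lt_succ_of_le ((countGE_le_card _ _).trans hi)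
  · have h' := isCompatible_labelIH_iff.not.1 h
    rw [if_neg fun h'' => h' fun j hj => h'' j (by simpa using hj), zero_mul, labelArray, if_neg h]

theorem exists_labelIH_eq {n : ℕ} {v : Fin n → ℕ} (hv : IsLabelling v) (hanti : Antitone v) :
    ∃ c, labelIH n c = v := by
  set e : ℕ → ℕ := fun i => if h : i < n then v ⟨i, h⟩ else 0
  have hlt : ∀ i (h : i < n), e i = v ⟨i, h⟩ := fun i h => dif_pos h
  have hge : ∀ i, n ≤ i → e i = 0 := fun i h => dif_neg (not_lt.2 h)
  have hstep : ∀ i, e (i + 1) ≤ e i := fun i => by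
    by_cases hi : i + 1 < n
    · rw [hlt _ hi, hlt i (by lia)]
      exact hanti (Fin.mk_le_mk.2 i.le_succ)
    · rw [hge _ (not_lt.1 hi)]
      exact Nat.zero_le _
  have he_anti : Antitone e := antitone_nat_of_succ_le hstep
  have hjump : ∀ i, e i ≤ e (i + 1) + 1 := fun i => by
    by_contra! hlt'
    have hi : i < n := by
      by_contra! hi
      rw [hge i hi] at hlt'
      lia
    obtain ⟨j, hj⟩ := hv ⟨i, hi⟩ (e (i + 1) + 1) (by lia) (by rw [← hlt]; exact hlt'.le)
    rw [show v j = e j from (hlt j j.2).symm] at hj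
    rcases Nat.lt_or_ge i j with hij | hij
    · have := he_anti (show i + 1 ≤ (j : ℕ) from hij)
      lia
    · have := he_anti hij
      lia
  refine ⟨fun j => decide (e j ≠ e (j + 1)), ?_⟩
  set P := PsetIH n fun j => decide (e j ≠ e (j + 1)) with hPdef
  have hP : ∀ i, i ∈ P ↔ e i ≠ e (i + 1) := fun i => by
    rw [hPdef, mem_PsetIH]
    simp only [decide_eq_true_eq, exists_prop, and_iff_right_iff_imp]
    intro hne
    by_contra! hi
    exact hne (by rw [hge i hi, hge (i + 1) (by lia)])
  have hcount : ∀ k i, i + k = n → countGE P i = e i := by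
    intro k
    induction k with
    | zero =>
      intro i hi
      rw [hge i (by lia), countGE_eq_zero]
      intro p hp
      exact (lt_of_mem_PsetIH hp).trans_le (by lia)
    | succ k ih =>
      intro i hi
      have := hstep i
      have := hjump i
      rw [countGE_eq_add, ih (i + 1) (by lia)]
      simp only [hP]
      split_ifs <;> lia
  funext j
  rw [labelIH, hcount (n - j) j (by lia), hlt j j.2]

theorem setOf_fIH_comp_perm_eq (n : ℕ) :
    {f : (Fin n → Bool) → ℤ | ∃ (c : Fin n → Bool) (σ : Equiv.Perm (Fin n)),
        f = fun x => fIH n c (fun j => x (σ j))} = labelArray '' (labellings n) := by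
  have hcomp : ∀ (w : Fin n → ℕ) (σ : Equiv.Perm (Fin n)),
      (fun x : Fin n → Bool => labelArray (w ∘ σ) fun j => x (σ j)) = labelArray w := fun w σ =>
    funext fun x => labelArray_comp_perm w x σ
  have hperm : ∀ (w : Fin n → ℕ) (σ : Equiv.Perm (Fin n)), w ∈ labellings n →
      w ∘ σ ∈ labellings n := fun w σ hw => by
    rw [mem_labellings] at hw ⊢
    refine ⟨fun j => hw.1 _, fun j i hi hij => ?_⟩
    obtain ⟨j', hj'⟩ := hw.2 (σ j) i hi hij
    exact ⟨σ.symm j', by simpa using hj'⟩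
  ext f
  constructor
  · rintro ⟨c, σ, rfl⟩
    refine ⟨labelIH n c ∘ σ.symm, hperm _ _ (labelIH_mem n c), ?_⟩
    rw [← hcomp _ σ, fIH_eq_labelArray, Function.comp_assoc, Equiv.symm_comp_self,
      Function.comp_id]
  · rintro ⟨w, hw, rfl⟩
    set σ := Tuple.sort (OrderDual.toDual ∘ w)
    have hanti : Antitone (w ∘ σ) := fun a b hab =>
      Tuple.monotone_sort (OrderDual.toDual ∘ w) hab
    obtain ⟨c, hc⟩ := exists_labelIH_eq (mem_labellings.1 (hperm w σ hw)).2 hanti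
    exact ⟨c, σ, by rw [fIH_eq_labelArray, hc, hcomp]⟩

end

/-- Theorem 2 of the paper: the number of distinct sequences obtained from the
arrays `f_c`, `c ∈ {I,H}^n`, by all coordinate permutations, is
`E_IH(n) = 2^{n-1} + ∑_{k=0}^n k! S(n,k)`. -/
theorem stmt4 (n : ℕ) (hn : 1 ≤ n) :
    ({f : (Fin n → Bool) → ℤ | ∃ (c : Fin n → Bool) (σ : Equiv.Perm (Fin n)),
        f = fun x => fIH n c (fun j => x (σ j))}).ncard =
      2 ^ (n - 1) + ∑ k ∈ Finset.range (n + 1), Nat.factorial k * stirling2 n k := by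
  classical
  have h := two_mul_card_image (T := labellings n) (φ := labelArray) (ρ := reverseLabels)
    (fun w hw => reverseLabels_mem hw) (fun w hw w' hw' => labelArray_eq_iff hw' hw)
  rw [card_labellings hn, card_filter_reverseLabels_eq hn] at h
  rw [setOf_fIH_comp_perm_eq, ← Finset.coe_image, Set.ncard_coe_finset]
  obtain ⟨k, rfl⟩ := Nat.exists_eq_add_of_le' hn
  rw [pow_succ] at h
  rw [Nat.add_sub_cancel]
  lia
end

section
/- Let E(n) = 3·∑_{k=0}^{n} 2^{k-2}·k!·S(n,k) + 2^n − 1/2 (a rational number), where S(n,k) denotes the Stirling number of the second kind. Then lim_{n→∞} E(n) · 4·(ln(3/2))^{n+1} / n! = 1; that is, E(n) is asymptotically equal to n! / (4·(ln(3/2))^{n+1}). -/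
/-- `E_IHN(n) = 3 ∑_{k=0}^n 2^{k-2} k! S(n,k) + 2^n - 1/2`, a rational number. -/
def EIHN (n : ℕ) : ℚ :=
  3 * ∑ k ∈ Finset.range (n + 1),
      (2 : ℚ) ^ ((k : ℤ) - 2) * Nat.factorial k * stirling2 n k
    + 2 ^ n - 1 / 2

open MeasureTheory Set Filter in
theorem abs_hasSum_sub_integral_Ioi_le {f g : ℝ → ℝ} {s : ℝ} (hf : Differentiable ℝ f)
    (hg : Continuous g) (hfg : ∀ t, 0 ≤ t → |deriv f t| ≤ g t) (hfi : IntegrableOn f (Ioi 0))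
    (hgi : IntegrableOn g (Ioi 0)) (hs : HasSum (fun m : ℕ => f m) s) :
    |s - ∫ t in Ioi 0, f t| ≤ ∫ t in Ioi 0, g t := by
  have hcast : Tendsto (fun N : ℕ => (N : ℝ)) atTop atTop := tendsto_natCast_atTop_atTop
  have hF := intervalIntegral_tendsto_integral_Ioi 0 hfi hcast
  have hG := intervalIntegral_tendsto_integral_Ioi 0 hgi hcast
  refine le_of_tendsto_of_tendsto' (hs.tendsto_sum_nat.sub hF).abs hG fun N => ?_
  have hfint (a b : ℝ) : IntervalIntegrable f volume a b := hf.continuous.intervalIntegrable a b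
  have hgint (a b : ℝ) : IntervalIntegrable g volume a b := hg.intervalIntegrable a b
  have hFsum := intervalIntegral.sum_integral_adjacent_intervals (a := fun k : ℕ => (k : ℝ))
    (n := N) fun k _ => hfint k (k + 1 : ℕ)
  have hGsum := intervalIntegral.sum_integral_adjacent_intervals (a := fun k : ℕ => (k : ℝ))
    (n := N) fun k _ => hgint k (k + 1 : ℕ)
  simp only [Nat.cast_zero] at hFsum hGsum
  rw [← hFsum, ← hGsum, ← Finset.sum_sub_distrib]
  refine (Finset.abs_sum_le_sum_abs _ _).trans (Finset.sum_le_sum fun m _ => ?_)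
  have hm : (m : ℝ) ≤ (m + 1 : ℕ) := by push_cast; linarith
  have hosc : ∀ t ∈ uIoc (m : ℝ) (m + 1 : ℕ),
      ‖f t - f m‖ ≤ ∫ u in (m : ℝ)..(m + 1 : ℕ), g u := by
    intro t ht
    rw [uIoc_of_le hm] at ht
    refine (norm_sub_le_integral_of_norm_deriv_le_of_le ht.1.le hf.continuous.continuousOn
      hf.differentiableOn (ae_of_all _ fun u hu => hfg u (m.cast_nonneg.trans hu.1.le))
      (hgint _ _)).trans ?_
    refine intervalIntegral.integral_mono_interval le_rfl ht.1.le ht.2 ?_ (hgint _ _)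
    filter_upwards [ae_restrict_mem measurableSet_Ioc] with u hu
    exact (abs_nonneg _).trans (hfg u (m.cast_nonneg.trans hu.1.le))
  have hdiff := intervalIntegral.norm_integral_le_of_norm_le_const hosc
  rw [intervalIntegral.integral_sub (hfint _ _) intervalIntegrable_const,
    intervalIntegral.integral_const] at hdiff
  simpa [abs_sub_comm] using hdiff

theorem integrableOn_pow_mul_exp_neg_mul_Ioi {c : ℝ} (hc : 0 < c) (n : ℕ) :
    MeasureTheory.IntegrableOn (fun t : ℝ => t ^ n * Real.exp (-(c * t))) (Set.Ioi 0) := by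
  have hn : (-1 : ℝ) < n := by linarith [n.cast_nonneg (α := ℝ)]
  simpa using integrableOn_rpow_mul_exp_neg_mul_rpow (s := n) (p := 1) (b := c) hn one_pos hc

theorem integral_pow_mul_exp_neg_mul_Ioi {c : ℝ} (hc : 0 < c) (n : ℕ) :
    ∫ t in Set.Ioi (0 : ℝ), t ^ n * Real.exp (-(c * t)) = n.factorial / c ^ (n + 1) := by
  have h := Real.integral_rpow_mul_exp_neg_mul_Ioi (a := n + 1) (by positivity) hc
  simp only [add_sub_cancel_right, Real.rpow_natCast, Real.Gamma_nat_eq_factorial] at h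
  rw [h, ← Nat.cast_add_one, Real.rpow_natCast, one_div, inv_pow, inv_mul_eq_div]

theorem abs_sub_factorial_div_le_of_hasSum {c s : ℝ} (hc : 0 < c) (k : ℕ)
    (hs : HasSum (fun m : ℕ => (m : ℝ) ^ (k + 1) * Real.exp (-(c * m))) s) :
    |s - (k + 1).factorial / c ^ (k + 2)| ≤ √(k + 1) * (k.factorial / c ^ (k + 1)) := by
  set q : ℝ := √(k + 1)
  have hq : 0 < q := Real.sqrt_pos.2 (by positivity)
  have hqq : q ^ 2 = k + 1 := Real.sq_sqrt (by positivity)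
  let e (j : ℕ) (t : ℝ) : ℝ := t ^ j * Real.exp (-(c * t))
  have hderiv (t : ℝ) : HasDerivAt (e (k + 1))
      ((k + 1 - c * t) * (t ^ k * Real.exp (-(c * t)))) t := by
    have h := (hasDerivAt_pow (k + 1) t).mul ((hasDerivAt_id t).const_mul c).neg.exp
    convert! h using 1
    simp
    ring
  let g (t : ℝ) : ℝ := ((k + 1) ^ 2 / (2 * q) + q / 2) * e k t
    + (-((k + 1) * c / q) * e (k + 1) t + c ^ 2 / (2 * q) * e (k + 2) t)
  have hbound (t : ℝ) (ht : 0 ≤ t) : |deriv (e (k + 1)) t| ≤ g t := by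
    have hAMGM : |k + 1 - c * t| ≤ (k + 1 - c * t) ^ 2 / (2 * q) + q / 2 := by
      have : (k + 1 - c * t) ^ 2 / (2 * q) + q / 2 - |k + 1 - c * t|
          = (|k + 1 - c * t| - q) ^ 2 / (2 * q) := by
        rw [← sq_abs (k + 1 - c * t)]
        field_simp
        ring
      have : 0 ≤ (|k + 1 - c * t| - q) ^ 2 / (2 * q) := by positivity
      linarith
    rw [(hderiv t).deriv, abs_mul,
      abs_of_nonneg (show 0 ≤ t ^ k * Real.exp (-(c * t)) by positivity)]
    refine (mul_le_mul_of_nonneg_right hAMGM (by positivity)).trans_eq ?_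
    simp only [g, e]
    field_simp
    ring
  have hint (j : ℕ) (a : ℝ) := (integrableOn_pow_mul_exp_neg_mul_Ioi hc j).const_mul a
  have hgi : ∫ t in Set.Ioi 0, g t = q * (k.factorial / c ^ (k + 1)) := by
    simp only [g, e]
    rw [MeasureTheory.integral_add (hint _ _) (by exact (hint _ _).add (hint _ _)),
      MeasureTheory.integral_add (hint _ _) (hint _ _)]
    simp only [MeasureTheory.integral_const_mul, integral_pow_mul_exp_neg_mul_Ioi hc,
      Nat.factorial_succ, Nat.cast_mul, Nat.cast_add, Nat.cast_one]
    field_simp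
    rw [hqq]
    ring
  rw [← hgi, ← integral_pow_mul_exp_neg_mul_Ioi hc]
  exact abs_hasSum_sub_integral_Ioi_le (fun t => (hderiv t).differentiableAt)
    (by fun_prop) hbound (integrableOn_pow_mul_exp_neg_mul_Ioi hc _)
    ((hint _ _).add ((hint _ _).add (hint _ _))) hs

theorem stirling2_eq_stirlingSecond (n k : ℕ) : stirling2 n k = Nat.stirlingSecond n k := by
  induction n generalizing k with
  | zero => cases k <;> rfl
  | succ n ih =>
    cases k with
    | zero => rfl
    | succ k => rw [stirling2, Nat.stirlingSecond_succ_succ, ih, ih]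

theorem pow_eq_sum_stirlingSecond_mul_descFactorial (m n : ℕ) :
    m ^ n = ∑ k ∈ Finset.range (n + 1), n.stirlingSecond k * m.descFactorial k := by
  induction n with
  | zero => simp
  | succ n ih =>
    have hstep (k : ℕ) : m * m.descFactorial k
        = m.descFactorial (k + 1) + k * m.descFactorial k := by
      rw [Nat.descFactorial_succ, ← add_mul]
      rcases le_or_gt k m with h | h
      · rw [Nat.sub_add_cancel h]
      · simp [Nat.descFactorial_of_lt h]
    have hshift : ∑ k ∈ Finset.range (n + 1), n.stirlingSecond k * (k * m.descFactorial k)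
        = ∑ k ∈ Finset.range (n + 1),
          n.stirlingSecond (k + 1) * ((k + 1) * m.descFactorial (k + 1)) := by
      have h := Finset.sum_range_succ'
        (fun k => n.stirlingSecond k * (k * m.descFactorial k)) (n + 1)
      rw [Finset.sum_range_succ, Nat.stirlingSecond_eq_zero_of_lt n.lt_succ_self] at h
      simpa using h
    rw [pow_succ', ih, Finset.mul_sum, Finset.sum_range_succ' _ (n + 1)]
    simp only [mul_left_comm m, hstep, mul_add, Finset.sum_add_distrib, hshift,
      Nat.stirlingSecond_succ_succ, add_mul, Nat.stirlingSecond_succ_zero, zero_mul, add_zero]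
    simp only [← Finset.sum_add_distrib]
    exact Finset.sum_congr rfl fun k _ => by ring

theorem hasSum_descFactorial_mul_geometric {r : ℝ} (hr : ‖r‖ < 1) (k : ℕ) :
    HasSum (fun m : ℕ => (m.descFactorial k : ℝ) * r ^ m)
      (k.factorial * (r ^ k / (1 - r) ^ (k + 1))) := by
  rw [← hasSum_nat_add_iff' k, Finset.sum_eq_zero, sub_zero]
  · convert! (hasSum_choose_mul_geometric_of_norm_lt_one k hr).mul_left (k.factorial * r ^ k)
      using 1
    · ext m
      rw [Nat.descFactorial_eq_factorial_mul_choose]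
      push_cast
      ring
    · ring
  · intro m hm
    simp [Nat.descFactorial_of_lt (Finset.mem_range.1 hm)]

theorem hasSum_pow_mul_geometric {r : ℝ} (hr : ‖r‖ < 1) (n : ℕ) :
    HasSum (fun m : ℕ => (m : ℝ) ^ n * r ^ m)
      (∑ k ∈ Finset.range (n + 1),
        n.stirlingSecond k * (k.factorial * (r ^ k / (1 - r) ^ (k + 1)))) := by
  convert! hasSum_sum fun k (_ : k ∈ Finset.range (n + 1)) =>
    (hasSum_descFactorial_mul_geometric hr k).mul_left (n.stirlingSecond k : ℝ) using 2 with m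
  rw [← Nat.cast_pow, pow_eq_sum_stirlingSecond_mul_descFactorial]
  push_cast
  rw [Finset.sum_mul]
  exact Finset.sum_congr rfl fun k _ => by ring

theorem hasSum_pow_mul_exp_neg_log_eq_EIHN (n : ℕ) :
    HasSum (fun m : ℕ => (m : ℝ) ^ n * Real.exp (-(Real.log (3 / 2) * m)))
      (4 * (EIHN n - 2 ^ n + 1 / 2)) := by
  convert! hasSum_pow_mul_geometric (r := 2 / 3) (by norm_num) n using 1
  · ext m
    rw [mul_comm (Real.log _), ← mul_neg, ← Real.log_inv, Real.exp_nat_mul,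
      Real.exp_log (by norm_num)]
    norm_num
  · simp only [EIHN, stirling2_eq_stirlingSecond]
    push_cast
    rw [show ∀ a b : ℝ, 4 * (3 * a + b - 1 / 2 - b + 1 / 2) = 12 * a by intros; ring,
      Finset.mul_sum]
    refine Finset.sum_congr rfl fun k _ => ?_
    rw [zpow_sub₀ two_ne_zero, zpow_natCast, show (1 - 2 / 3 : ℝ) = 1 / 3 by norm_num, div_pow,
      div_pow]
    field_simp
    norm_num
    ring

/-- The asymptotic formula (16) of the paper:
`E_IHN(n) ∼ n! / (4 (ln (3/2))^{n+1})`, i.e.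
`E_IHN(n) · 4 (ln (3/2))^{n+1} / n! → 1`. -/
theorem stmt7 :
    Filter.Tendsto
      (fun n : ℕ =>
        (EIHN n : ℝ) * 4 * Real.log (3 / 2) ^ (n + 1) / Nat.factorial n)
      Filter.atTop (nhds 1) := by
  set c : ℝ := Real.log (3 / 2)
  have hc : 0 < c := Real.log_pos (by norm_num)
  let main (n : ℕ) : ℝ := 4 * (EIHN n - 2 ^ n + 1 / 2) * c ^ (n + 1) / n.factorial
  have hmain : Filter.Tendsto main Filter.atTop (nhds 1) := by
    rw [← Filter.tendsto_add_atTop_iff_nat 1, tendsto_iff_norm_sub_tendsto_zero]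
    have hlim : Filter.Tendsto (fun k : ℕ => c / √((k + 1 : ℕ) : ℝ)) Filter.atTop (nhds 0) :=
      ((Real.tendsto_sqrt_atTop.comp tendsto_natCast_atTop_atTop).comp
        (Filter.tendsto_add_atTop_nat 1)).const_div_atTop c
    refine squeeze_zero (fun _ => norm_nonneg _) (fun k => ?_) hlim
    have h := abs_sub_factorial_div_le_of_hasSum hc k (hasSum_pow_mul_exp_neg_log_eq_EIHN (k + 1))
    have hw : 0 < c ^ (k + 2) / (k + 1).factorial := by positivity
    have hq : √((k : ℝ) + 1) ^ 2 = k + 1 := Real.sq_sqrt (by positivity)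
    calc ‖main (k + 1) - 1‖
        = |4 * (EIHN (k + 1) - 2 ^ (k + 1) + 1 / 2) - (k + 1).factorial / c ^ (k + 2)|
            * (c ^ (k + 2) / (k + 1).factorial) := by
          rw [← abs_of_pos hw, ← abs_mul, Real.norm_eq_abs]
          congr 1
          simp only [main]
          field_simp
      _ ≤ √(k + 1) * (k.factorial / c ^ (k + 1)) * (c ^ (k + 2) / (k + 1).factorial) := by gcongr
      _ = c / √((k + 1 : ℕ) : ℝ) := by
          rw [Nat.factorial_succ]
          push_cast
          field_simp
          rw [hq]
          ring
  have hexp (x : ℝ) := FloorSemiring.tendsto_pow_div_factorial_atTop x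
  have hrest := (((hexp (2 * c)).const_mul (4 * c)).sub ((hexp c).const_mul (2 * c)))
  convert! hmain.add hrest using 1
  · ext n
    simp only [main]
    field_simp
    ring
  · simp
end
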